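/- For every integer k ≥ 2 and every integer r ≥ 2k·⌈k/2⌉, the rainbow k-connectivity of the complete bipartite graph K_{r,r} equals 3, i.e., rc_k(K_{r,r}) = 3. -/

import Mathlib

open SimpleGraph

/-- The complete bipartite graph `K_{r,r}` with both parts `Fin r`. -/
abbrev Krr (r : ℕ) : SimpleGraph (Fin r ⊕ Fin r) :=
  completeBipartiteGraph (Fin r) (Fin r)

/-- A walk is a rainbow path (w.r.t. edge-coloring `c`) if it is a path and
all its edges receive pairwise distinct colors. -/
def RainbowPath {V α : Type*} {G : SimpleGraph V} (c : Sym2 V → α) {u v : V}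
    (p : G.Walk u v) : Prop :=
  p.IsPath ∧ (p.edges.map c).Nodup

/-- Two `u`-`v` walks are internally disjoint if they share no vertices other
than `u` and `v`. -/
def IntDisjoint {V : Type*} {G : SimpleGraph V} {u v : V}
    (p q : G.Walk u v) : Prop :=
  ∀ x, x ∈ p.support → x ∈ q.support → x = u ∨ x = v

/-- `G` admits a `j`-edge-coloring under which every two distinct vertices are
joined by at least `k` internally disjoint rainbow paths. -/
def HasRainbowKColoring {V : Type*} (G : SimpleGraph V) (k j : ℕ) : Prop :=
  ∃ c : Sym2 V → Fin j, ∀ u v : V, u ≠ v →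
    ∃ P : Fin k → G.Walk u v, Function.Injective P ∧
      (∀ i, RainbowPath c (P i)) ∧
      ∀ i i', i ≠ i' → IntDisjoint (P i) (P i')

/-- The rainbow `k`-connectivity: the least number of colors as above. -/
noncomputable def rck {V : Type*} (G : SimpleGraph V) (k : ℕ) : ℕ :=
  sInf {j | HasRainbowKColoring G k j}

/-- The edge colouring of `K_{r,r}` induced by an `r × r` matrix. -/
def matCol {r : ℕ} (f : Fin r → Fin r → Fin 3) : Sym2 (Fin r ⊕ Fin r) → Fin 3 :=
  Sym2.lift ⟨fun p q => match p, q with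
    | .inl a, .inr b => f a b
    | .inr b, .inl a => f a b
    | _, _ => 0, by
      rintro (a | a) (b | b) <;> rfl⟩

/-- The path of length two through `w`. -/
def path2 {V : Type*} {G : SimpleGraph V} {u v w : V} (h1 : G.Adj u w) (h2 : G.Adj w v) :
    G.Walk u v := .cons h1 (.cons h2 .nil)

/-- The path of length three through `w`, `z`. -/
def path3 {V : Type*} {G : SimpleGraph V} {u v w z : V} (h1 : G.Adj u w) (h2 : G.Adj w z)
    (h3 : G.Adj z v) :
    G.Walk u v := .cons h1 (.cons h2 (.cons h3 .nil))

lemma intDisjoint_symm {V : Type*} {G : SimpleGraph V} {u v : V} {p q : G.Walk u v}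
    (h : IntDisjoint p q) : IntDisjoint q p := fun x h1 h2 => h x h2 h1

/-- Reversal of a family of rainbow paths. -/
lemma reverse_family {V α : Type*} {G : SimpleGraph V} {k : ℕ} (c : Sym2 V → α) {u v : V}
    (h : ∃ P : Fin k → G.Walk u v, Function.Injective P ∧
      (∀ i, RainbowPath c (P i)) ∧ ∀ i i', i ≠ i' → IntDisjoint (P i) (P i')) :
    ∃ P : Fin k → G.Walk v u, Function.Injective P ∧
      (∀ i, RainbowPath c (P i)) ∧ ∀ i i', i ≠ i' → IntDisjoint (P i) (P i') := by
  obtain ⟨P, h1, h2, h3⟩ := h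
  refine ⟨fun i => (P i).reverse, ?_, ?_, ?_⟩
  · intro i j hij
    exact h1 (Walk.reverse_injective hij)
  · intro i
    refine ⟨(h2 i).1.reverse, ?_⟩
    simp only [Walk.edges_reverse, List.map_reverse, List.nodup_reverse]
    exact (h2 i).2
  · intro i j hij x hx hx'
    simp only [Walk.support_reverse, List.mem_reverse] at hx hx'
    exact (h3 i j hij x hx hx').symm

lemma hasRainbow_of_matrix {r k : ℕ} (f : Fin r → Fin r → Fin 3)
    (h1 : ∀ u u', u ≠ u' → ∃ e : Fin k → Fin r, Function.Injective e ∧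
      ∀ i, f u (e i) ≠ f u' (e i))
    (h2 : ∀ u u', u ≠ u' → ∃ e : Fin k → Fin r, Function.Injective e ∧
      ∀ i, f (e i) u ≠ f (e i) u')
    (h3 : ∀ u v, ∃ (j : Fin k) (y x : Fin k → Fin r),
      (∀ i i', i ≠ j → i' ≠ j → y i = y i' → i = i') ∧
      (∀ i i', i ≠ j → i' ≠ j → x i = x i' → i = i') ∧
      ∀ i, i ≠ j → f u (y i) ≠ f (x i) (y i) ∧ f u (y i) ≠ f (x i) v ∧
        f (x i) (y i) ≠ f (x i) v) :
    HasRainbowKColoring (Krr r) k 3 := by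
  have key : ∀ u v : Fin r, ∃ P : Fin k → (Krr r).Walk (.inl u) (.inr v), Function.Injective P ∧
      (∀ i, RainbowPath (matCol f) (P i)) ∧ ∀ i i', i ≠ i' → IntDisjoint (P i) (P i') := by
    intro u v
    obtain ⟨j, y, x, hy, hx, hc⟩ := h3 u v
    have hxu : ∀ i, i ≠ j → x i ≠ u := by
      intro i hi h
      have := (hc i hi).1
      rw [h] at this
      exact this rfl
    have hyv : ∀ i, i ≠ j → y i ≠ v := by
      intro i hi h
      have := (hc i hi).2.2
      rw [h] at this
      exact this rfl
    refine ⟨fun i => if i = j then .cons (by simp) .nil else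
      path3 (w := .inr (y i)) (z := .inl (x i)) (by simp) (by simp) (by simp), ?_, ?_, ?_⟩
    · intro i i' h
      have h' := congrArg Walk.support h
      by_cases hi : i = j <;> by_cases hi' : i' = j
      · rw [hi, hi']
      · simp [hi, hi', path3] at h'
      · simp [hi, hi', path3] at h'
      · simp [hi, hi', path3] at h'
        exact hy i i' hi hi' h'.1
    · intro i
      by_cases hi : i = j
      · simp [hi, RainbowPath, Walk.isPath_def]
      · have a1 := hxu i hi
        have a2 := hyv i hi
        have a3 := hc i hi
        simp only [hi, if_false, RainbowPath, Walk.isPath_def, path3]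
        refine ⟨?_, ?_⟩
        · simp [a1.symm, a2]
        · simp [matCol, a3.1, a3.2.1, a3.2.2]
    · intro i i' hii z
      by_cases hi : i = j <;> by_cases hi' : i' = j
      · exact absurd (hi.trans hi'.symm) hii
      · simp only [hi]; simp; tauto
      · simp [hi']
      · have b1 : y i ≠ y i' := fun h => hii (hy i i' hi hi' h)
        have b2 : x i ≠ x i' := fun h => hii (hx i i' hi hi' h)
        simp only [hi, hi', if_false, path3, Walk.support_cons, Walk.support_nil,
          List.mem_cons, List.not_mem_nil, or_false]
        rintro (h | h | h | h) h'
        · exact Or.inl h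
        · rw [h] at h' ⊢
          simpa [b1] using h'
        · rw [h] at h' ⊢
          simpa [b2] using h'
        · exact Or.inr h
  refine ⟨matCol f, ?_⟩
  rintro (u | u) (v | v) huv
  · obtain ⟨e, he, hc⟩ := h1 u v (by simpa using huv)
    have huv' : u ≠ v := by simpa using huv
    refine ⟨fun i => path2 (w := .inr (e i)) (by simp) (by simp), ?_, ?_, ?_⟩
    · intro i i' h
      have h' := congrArg Walk.support h
      simp [path2] at h'
      exact he h'
    · intro i
      simp [RainbowPath, Walk.isPath_def, path2, huv', matCol, hc i]
    · intro i i' hii z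
      have : e i ≠ e i' := fun h => hii (he h)
      simp only [path2, Walk.support_cons, Walk.support_nil,
          List.mem_cons, List.not_mem_nil, or_false]
      rintro (h | h | h) h'
      · exact Or.inl h
      · rw [h] at h'
        simp [this] at h'
      · exact Or.inr h
  · exact key u v
  · exact reverse_family _ (key v u)
  · obtain ⟨e, he, hc⟩ := h2 u v (by simpa using huv)
    have huv' : u ≠ v := by simpa using huv
    refine ⟨fun i => path2 (w := .inl (e i)) (by simp) (by simp), ?_, ?_, ?_⟩
    · intro i i' h
      have h' := congrArg Walk.support h
      simp [path2] at h'
      exact he h'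
    · intro i
      simp [RainbowPath, Walk.isPath_def, path2, huv', matCol, hc i]
    · intro i i' hii z
      have : e i ≠ e i' := fun h => hii (he h)
      simp only [path2, Walk.support_cons, Walk.support_nil,
          List.mem_cons, List.not_mem_nil, or_false]
      rintro (h | h | h) h'
      · exact Or.inl h
      · rw [h] at h'
        simp [this] at h'
      · exact Or.inr h

/-- The lower bound. -/
lemma three_le {r k j : ℕ} (hk : 2 ≤ k) (hr : 0 < r) (h : HasRainbowKColoring (Krr r) k j) :
    3 ≤ j := by
  obtain ⟨c, hc⟩ := h
  obtain ⟨P, hP, hR, -⟩ := hc (.inl ⟨0, hr⟩) (.inr ⟨0, hr⟩) (by simp)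
  by_contra hj
  have huniq : ∀ p : (Krr r).Walk (.inl ⟨0, hr⟩) (.inr ⟨0, hr⟩), RainbowPath c p →
      p = .cons (by simp) .nil := by
    intro p hp
    have hlen : p.length ≤ j := by
      have := hp.2.length_le_card
      simpa using this
    cases p with
    | cons h p' =>
      cases p' with
      | nil => rfl
      | @cons _ w _ h' p'' =>
        cases p'' with
        | nil =>
          rename_i z
          rcases z with z | z <;> simp at h h'
        | cons h'' p''' =>
          simp at hlen
          omega
  have h01 := hP ((huniq _ (hR ⟨0, by omega⟩)).trans (huniq _ (hR ⟨1, by omega⟩)).symm)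
  simp at h01

/-- The block colouring. -/
def blk (k x y : ℕ) : Fin 3 := if x / k = y / k then 0 else if x % k = y % k then 1 else 2

lemma blk_comm (k x y : ℕ) : blk k x y = blk k y x := by
  unfold blk; simp only [eq_comm]

lemma pt_lt {k b i r : ℕ} (hi : i < k) (h : (b + 1) * k ≤ r) : b * k + i < r := by
  have : (b + 1) * k = b * k + k := by ring
  omega

lemma pt_div {k b i : ℕ} (hi : i < k) : (b * k + i) / k = b := by
  rw [Nat.div_eq_iff (by omega)]; constructor
  · omega
  · have : (b + 1) * k = b * k + k := by ring
    omega

lemma pt_mod {k b i : ℕ} (hi : i < k) : (b * k + i) % k = i := by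
  rw [Nat.mul_comm, Nat.mul_add_mod, Nat.mod_eq_of_lt hi]

lemma pt_inj {k b i b' i' : ℕ} (hi : i < k) (hi' : i' < k) (h : b * k + i = b' * k + i') :
    b = b' ∧ i = i' := by
  constructor
  · rw [← pt_div (b := b) hi, h, pt_div hi']
  · rw [← pt_mod (b := b) hi, h, pt_mod hi']

lemma full_of_lt {k r b b' x : ℕ} (hx : x < r) (hb : x / k = b') (h : b < b') :
    (b + 1) * k ≤ r := by
  have : b' * k ≤ x := by rw [← hb]; exact Nat.div_mul_le_self x k
  have : (b + 1) * k ≤ b' * k := Nat.mul_le_mul_right k h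
  omega

lemma blk_rows {k r : ℕ} (hk : 2 ≤ k) (hr : k * k ≤ r) (u u' : Fin r) (huu : u ≠ u') :
    ∃ e : Fin k → Fin r, Function.Injective e ∧ ∀ i, blk k u (e i) ≠ blk k u' (e i) := by
  have main : ∀ u u' : Fin r, u.1 / k < u'.1 / k →
      ∃ e : Fin k → Fin r, Function.Injective e ∧ ∀ i, blk k u (e i) ≠ blk k u' (e i) := by
    intro u u' hlt
    have hf := full_of_lt u'.2 rfl hlt
    refine ⟨fun i => ⟨(u.1 / k) * k + i, pt_lt i.2 hf⟩, ?_, ?_⟩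
    · intro i i' h
      simp only [Fin.mk.injEq] at h
      exact Fin.ext (pt_inj i.2 i'.2 h).2
    · intro i
      have : u'.1 / k ≠ u.1 / k := by omega
      simp only [blk, pt_div i.2, pt_mod i.2, this, if_true, if_false]
      split_ifs <;> simp
  rcases lt_trichotomy (u.1 / k) (u'.1 / k) with h | h | h
  · exact main u u' h
  · have hmod : u.1 % k ≠ u'.1 % k := by
      intro hm
      apply huu
      apply Fin.ext
      rw [← Nat.div_add_mod u.1 k, h, hm, Nat.div_add_mod]
    have hfull : ∀ b, b < k → (b + 1) * k ≤ r := fun b hb =>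
      (Nat.mul_le_mul_right k hb).trans hr
    have hu := Nat.mod_lt u.1 (show 0 < k by omega)
    have hu' := Nat.mod_lt u'.1 (show 0 < k by omega)
    obtain ⟨d0, hd0, hd0'⟩ : ∃ d0, d0 < k ∧ d0 ≠ u'.1 / k := by
      by_cases hz : u'.1 / k = 0
      · exact ⟨1, by omega, by omega⟩
      · exact ⟨0, by omega, by omega⟩
    refine ⟨fun i => if i.1 = u'.1 / k then ⟨d0 * k + u'.1 % k, pt_lt hu' (hfull _ hd0)⟩
      else ⟨i.1 * k + u.1 % k, pt_lt hu (hfull _ i.2)⟩, ?_, ?_⟩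
    · intro i i' hii
      dsimp only at hii
      split_ifs at hii with c1 c2 c2
      · exact Fin.ext (c1.trans c2.symm)
      · simp only [Fin.mk.injEq] at hii
        exact absurd (pt_inj hu' hu hii).2.symm hmod
      · simp only [Fin.mk.injEq] at hii
        exact absurd (pt_inj hu hu' hii).2 hmod
      · simp only [Fin.mk.injEq] at hii
        exact Fin.ext (pt_inj hu hu hii).1
    · intro i
      by_cases c1 : i.1 = u'.1 / k
      · simp [c1, blk, pt_div hu', pt_mod hu', h, hd0'.symm, hmod, -Nat.mul_add_mod_self_right]
      · simp [c1, blk, pt_div hu, pt_mod hu, h, Ne.symm c1, hmod.symm,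
          -Nat.mul_add_mod_self_right]
  · obtain ⟨e, he, hc⟩ := main u' u h
    exact ⟨e, he, fun i => (hc i).symm⟩

lemma exists_third (s t : ℕ) : ∃ b, b < 3 ∧ b ≠ s ∧ b ≠ t := by
  by_cases h0 : s ≠ 0 ∧ t ≠ 0
  · exact ⟨0, by omega, by omega, by omega⟩
  by_cases h1 : s ≠ 1 ∧ t ≠ 1
  · exact ⟨1, by omega, by omega, by omega⟩
  · exact ⟨2, by omega, by omega, by omega⟩

lemma blk_paths {k r : ℕ} (hk : 2 ≤ k) (hr : k * k ≤ r) (hr3 : 3 * k ≤ r) (u v : Fin r) :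
    ∃ (j : Fin k) (y x : Fin k → Fin r),
      (∀ i i', i ≠ j → i' ≠ j → y i = y i' → i = i') ∧
      (∀ i i', i ≠ j → i' ≠ j → x i = x i' → i = i') ∧
      ∀ i, i ≠ j → blk k u (y i) ≠ blk k (x i) (y i) ∧ blk k u (y i) ≠ blk k (x i) v ∧
        blk k (x i) (y i) ≠ blk k (x i) v := by
  have hfull : ∀ b, b < k → (b + 1) * k ≤ r := fun b hb =>
    (Nat.mul_le_mul_right k hb).trans hr
  have hu := Nat.mod_lt u.1 (show 0 < k by omega)
  have hv := Nat.mod_lt v.1 (show 0 < k by omega)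
  have main : ∀ u v : Fin r, u.1 / k < v.1 / k → ∃ (j : Fin k) (y x : Fin k → Fin r),
      (∀ i i', i ≠ j → i' ≠ j → y i = y i' → i = i') ∧
      (∀ i i', i ≠ j → i' ≠ j → x i = x i' → i = i') ∧
      ∀ i, i ≠ j → blk k u (y i) ≠ blk k (x i) (y i) ∧ blk k u (y i) ≠ blk k (x i) v ∧
        blk k (x i) (y i) ≠ blk k (x i) v := by
    intro u v hlt
    have hv := Nat.mod_lt v.1 (show 0 < k by omega)
    have hf := full_of_lt v.2 rfl hlt
    obtain ⟨b, hb3, hbu, hbv⟩ := exists_third (u.1 / k) (v.1 / k)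
    have hbf : (b + 1) * k ≤ r := (Nat.mul_le_mul_right k hb3).trans hr3
    refine ⟨⟨v.1 % k, hv⟩, fun i => ⟨(u.1 / k) * k + i, pt_lt i.2 hf⟩,
      fun i => ⟨b * k + i, pt_lt i.2 hbf⟩, ?_, ?_, ?_⟩
    · intro i i' _ _ h
      simp only [Fin.mk.injEq] at h
      exact Fin.ext (pt_inj i.2 i'.2 h).2
    · intro i i' _ _ h
      simp only [Fin.mk.injEq] at h
      exact Fin.ext (pt_inj i.2 i'.2 h).2
    · intro i hi
      have hi' : i.1 ≠ v.1 % k := fun h => hi (Fin.ext h)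
      simp only [blk, pt_div i.2, pt_mod i.2, hbu, hbv, hi', if_true, if_false]
      decide
  rcases lt_trichotomy (u.1 / k) (v.1 / k) with h | h | h
  · exact main u v h
  · obtain ⟨a, ha, hav⟩ : ∃ a, a < k ∧ a ≠ v.1 % k := by
      by_cases hz : v.1 % k = 0
      · exact ⟨1, by omega, by omega⟩
      · exact ⟨0, by omega, by omega⟩
    obtain ⟨j, hj⟩ : ∃ j : Fin k, ∀ i : Fin k, i ≠ j → i.1 ≠ v.1 / k := by
      by_cases hz : v.1 / k < k
      · exact ⟨⟨v.1 / k, hz⟩, fun i hi h => hi (Fin.ext h)⟩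
      · exact ⟨⟨0, by omega⟩, fun i _ => by omega⟩
    refine ⟨j, fun i => ⟨i.1 * k + u.1 % k, pt_lt hu (hfull _ i.2)⟩,
      fun i => ⟨i.1 * k + a, pt_lt ha (hfull _ i.2)⟩, ?_, ?_, ?_⟩
    · intro i i' _ _ h
      simp only [Fin.mk.injEq] at h
      exact Fin.ext (pt_inj hu hu h).1
    · intro i i' _ _ h
      simp only [Fin.mk.injEq] at h
      exact Fin.ext (pt_inj ha ha h).1
    · intro i hi
      have h1 := hj i hi
      simp only [blk, pt_div hu, pt_mod hu, pt_div ha, pt_mod ha, h, h1, h1.symm, hav,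
        if_true, if_false]
      decide
  · obtain ⟨j, y, x, hy, hx, hc⟩ := main v u h
    refine ⟨j, x, y, hx, hy, fun i hi => ?_⟩
    obtain ⟨c1, c2, c3⟩ := hc i hi
    rw [blk_comm k u, blk_comm k (y i) (x i), blk_comm k (y i) v]
    exact ⟨c3.symm, c2.symm, c1.symm⟩

lemma hasRainbow_of_symm_two {r : ℕ} (f : Fin r → Fin r → Fin 3)
    (hs : ∀ x y, f x y = f y x)
    (h1 : ∀ u u', u ≠ u' → ∃ p q, p ≠ q ∧ f u p ≠ f u' p ∧ f u q ≠ f u' q)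
    (h3 : ∀ u v, ∃ y x, f u y ≠ f x y ∧ f u y ≠ f x v ∧ f x y ≠ f x v) :
    HasRainbowKColoring (Krr r) 2 3 := by
  have h1' : ∀ u u', u ≠ u' → ∃ e : Fin 2 → Fin r, Function.Injective e ∧
      ∀ i, f u (e i) ≠ f u' (e i) := by
    intro u u' h
    obtain ⟨p, q, hpq, hp, hq⟩ := h1 u u' h
    refine ⟨![p, q], ?_, ?_⟩
    · intro i i'
      fin_cases i <;> fin_cases i' <;> simp [hpq, hpq.symm]
    · intro i
      fin_cases i <;> simp [hp, hq]
  refine hasRainbow_of_matrix f h1' ?_ ?_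
  · intro u u' h
    obtain ⟨e, he, hc⟩ := h1' u u' h
    exact ⟨e, he, fun i => by rw [hs _ u, hs _ u']; exact hc i⟩
  · intro u v
    obtain ⟨y, x, h⟩ := h3 u v
    exact ⟨0, fun _ => y, fun _ => x, fun i i' a b _ => by omega, fun i i' a b _ => by omega,
      fun _ _ => h⟩

lemma hasRainbow_three (k r : ℕ) (hk : 2 ≤ k) (hr : 2 * k * ((k + 1) / 2) ≤ r) :
    HasRainbowKColoring (Krr r) k 3 := by
  have hkk : k * k ≤ r := by
    refine le_trans ?_ hr
    have : k ≤ 2 * ((k + 1) / 2) := by omega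
    calc k * k ≤ k * (2 * ((k + 1) / 2)) := Nat.mul_le_mul_left k this
      _ = _ := by ring
  by_cases h3 : 3 * k ≤ r
  · refine hasRainbow_of_matrix (fun x y => blk k x y) (blk_rows hk hkk) ?_ (blk_paths hk hkk h3)
    intro u u' h
    obtain ⟨e, he, hc⟩ := blk_rows hk hkk u u' h
    exact ⟨e, he, fun i => by rw [blk_comm k _ u, blk_comm k _ u']; exact hc i⟩
  · have hk2 : k = 2 := by
      by_contra hne
      exact h3 ((Nat.mul_le_mul_right k (by omega)).trans hkk)
    subst hk2
    have hr' : r = 4 ∨ r = 5 := by omega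
    rcases hr' with rfl | rfl
    · exact hasRainbow_of_symm_two (fun x y => (![0, 0, 1, 2] : Fin 4 → Fin 3) (x + y))
        (by decide) (by decide) (by decide)
    · exact hasRainbow_of_symm_two (fun x y => (![0, 0, 0, 1, 2] : Fin 5 → Fin 3) (x + y))
        (by decide) (by decide) (by decide)

theorem stmt5 (k r : ℕ) (hk : 2 ≤ k) (hr : 2 * k * ((k + 1) / 2) ≤ r) :
    rck (Krr r) k = 3 := by
  have hr0 : 0 < r := by
    have : 0 < 2 * k * ((k + 1) / 2) := Nat.mul_pos (by omega) (by omega)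
    omega
  have h3 := hasRainbow_three k r hk hr
  apply le_antisymm
  · exact Nat.sInf_le h3
  · exact le_csInf ⟨3, h3⟩ fun j hj => three_le hk hr0 hj
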